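/- Let q be a real number with |q| < 1. Then -(1/3) T(q) + (1/4) S(q) = (1/3) Z(2)^2 - (1/12) Z(4), where T(q) = ∑_{i,j,k ≥ 1} q^{i+j+k} / ((1-q^i)(1-q^j)(1-q^k)(1-q^{i+j+k})) and S(q) = ∑_{i,j,k,ℓ ≥ 1, i+j = k+ℓ} q^{i+j} / ((1-q^i)(1-q^j)(1-q^k)(1-q^ℓ)). (The left-hand side is the weight-4 quasi-modular form Θ₂(q).) -/

import Mathlib

open scoped BigOperators

/-- Okounkov's `Z(2) = ∑_{n ≥ 1} qⁿ/(1-qⁿ)²`. -/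
noncomputable def Z2 (q : ℝ) : ℝ := ∑' n : ℕ+, q ^ (n : ℕ) / (1 - q ^ (n : ℕ)) ^ 2

/-- Okounkov's `Z(3) = ∑_{n ≥ 1} qⁿ(qⁿ+1)/(1-qⁿ)³`. -/
noncomputable def Z3 (q : ℝ) : ℝ :=
  ∑' n : ℕ+, q ^ (n : ℕ) * (q ^ (n : ℕ) + 1) / (1 - q ^ (n : ℕ)) ^ 3

/-- Okounkov's `Z(4) = ∑_{n ≥ 1} q²ⁿ/(1-qⁿ)⁴`. -/
noncomputable def Z4 (q : ℝ) : ℝ := ∑' n : ℕ+, q ^ (2 * (n : ℕ)) / (1 - q ^ (n : ℕ)) ^ 4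

/-! ### Lambert-type coefficients

All index sets are moved from `ℕ+` to `ℕ`: the coefficients below vanish at `0`. -/

/-- The coefficient `1 / (1 - qⁿ)`, which vanishes at `n = 0`. -/
noncomputable def lambertU (q : ℝ) (n : ℕ) : ℝ := (1 - q ^ n)⁻¹

/-- The coefficient `qⁿ / (1 - qⁿ)`, which vanishes at `n = 0`. -/
noncomputable def lambertA (q : ℝ) (n : ℕ) : ℝ := q ^ n * lambertU q n

/-- The partial sum `∑_{i < n} qⁱ / (1 - qⁱ)`. -/
noncomputable def lambertSum (q : ℝ) (n : ℕ) : ℝ := ∑ i ∈ Finset.range n, lambertA q i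

@[simp] lemma lambertU_zero (q : ℝ) : lambertU q 0 = 0 := by simp [lambertU]

@[simp] lemma lambertA_zero (q : ℝ) : lambertA q 0 = 0 := by simp [lambertA]

lemma lambertSum_succ (q : ℝ) (n : ℕ) : lambertSum q (n + 1) = lambertSum q n + lambertA q n :=
  Finset.sum_range_succ _ _

section Tsum

lemma tsum_pnat_eq_tsum {f : ℕ → ℝ} (h : f 0 = 0) : ∑' n : ℕ+, f n = ∑' n, f n := by
  refine PNat.coe_injective.tsum_eq fun n hn => ?_
  have : n ≠ 0 := fun h0 => hn (h0 ▸ h)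
  exact ⟨⟨n, Nat.pos_of_ne_zero this⟩, rfl⟩

lemma tsum_add_eq_tsum {f : ℕ → ℝ} (d : ℕ) (h : ∀ n < d, f n = 0) :
    ∑' n, f (n + d) = ∑' n, f n := by
  refine (add_left_injective d).tsum_eq (f := f) fun n hn => ?_
  have : d ≤ n := not_lt.1 fun h0 => hn (h n h0)
  exact ⟨n - d, by simp [this]⟩

lemma hasSum_antidiagonal {F : ℕ × ℕ → ℝ} (hF : Summable F) :
    HasSum (fun n => ∑ p ∈ Finset.HasAntidiagonal.antidiagonal n, F p) (∑' p, F p) := by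
  have h := (Finset.HasAntidiagonal.sigmaAntidiagonalEquivProd (A := ℕ)).hasSum_iff.2 hF.hasSum
  refine h.sigma fun n => ?_
  rw [← Finset.sum_coe_sort]
  exact hasSum_fintype _

lemma summable_pair_of_le {F : ℕ × ℕ → ℝ} {K r : ℝ} (k : ℕ) (hr0 : 0 ≤ r) (hr : r < 1)
    (h : ∀ i j : ℕ, |F (i, j)| ≤ K * ((((i : ℝ) + 1) ^ k * r ^ i) * (((j : ℝ) + 1) ^ k * r ^ j))) :
    Summable F := by
  have h1 : Summable fun i : ℕ => ((i : ℝ) + 1) ^ k * r ^ i := by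
    have h2 := summable_choose_mul_geometric_of_norm_lt_one k
      (r := r) (by rwa [Real.norm_of_nonneg hr0])
    refine Summable.of_nonneg_of_le (fun i => by positivity) (fun i => ?_)
      (h2.mul_left (k.factorial : ℝ))
    rw [← mul_assoc]
    gcongr
    have h3 := Nat.pow_succ_le_ascFactorial (i + 1) k
    have h4 := Nat.ascFactorial_eq_factorial_mul_choose (i + 1) k
    have : (i + 1) ^ k ≤ k.factorial * (i + k).choose k := by
      have h5 := Nat.ascFactorial_eq_factorial_mul_choose i k
      rw [← h5]
      exact h3
    exact_mod_cast this
  refine Summable.of_norm_bounded ((h1.mul_of_nonneg h1 (fun i => ?_) (fun i => ?_)).mul_left K)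
    fun p => h p.1 p.2
  all_goals positivity

lemma hasSum_split_diagonal {X : ℕ × ℕ → ℝ} (hX : Summable X)
    (hs : ∀ i d, X (i, i + d + 1) = X (i + d + 1, i)) :
    HasSum (fun d => 2 * ∑' i, X (i + d + 1, i)) (∑' p, X p - ∑' i, X (i, i)) := by
  let e₁ : ℕ × ℕ → ℕ × ℕ := fun p => (p.2, p.2 + p.1 + 1)
  let e₂ : ℕ × ℕ → ℕ × ℕ := fun p => (p.2 + p.1 + 1, p.2)
  let e₃ : ℕ → ℕ × ℕ := fun i => (i, i)
  have i₁ : Function.Injective e₁ := fun p r h => by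
    simp only [e₁, Prod.mk.injEq] at h; ext <;> omega
  have i₂ : Function.Injective e₂ := fun p r h => by
    simp only [e₂, Prod.mk.injEq] at h; ext <;> omega
  have i₃ : Function.Injective e₃ := fun p r h => by simpa [e₃] using h
  have s₁ : Summable (X ∘ e₁) := hX.comp_injective i₁
  have s₂ : Summable (X ∘ e₂) := hX.comp_injective i₂
  have heq : X ∘ e₁ = X ∘ e₂ := funext fun p => hs p.2 p.1
  have r₁ : Set.range e₁ = {p | p.1 < p.2} := by
    ext ⟨i, j⟩
    simp only [e₁, Set.mem_range, Prod.exists, Prod.mk.injEq, Set.mem_ofPred_eq]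
    exact ⟨by rintro ⟨d, l, rfl, rfl⟩; omega, fun h => ⟨j - i - 1, i, rfl, by omega⟩⟩
  have r₂ : Set.range e₂ = {p | p.2 < p.1} := by
    ext ⟨i, j⟩
    simp only [e₂, Set.mem_range, Prod.exists, Prod.mk.injEq, Set.mem_ofPred_eq]
    exact ⟨by rintro ⟨d, l, rfl, rfl⟩; omega, fun h => ⟨i - j - 1, j, by omega, rfl⟩⟩
  have r₃ : Set.range e₃ = {p | p.1 = p.2} := by
    ext ⟨i, j⟩
    simp [e₃]
  have t₁ := (i₁.hasSum_range_iff).2 s₁.hasSum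
  have t₂ := (i₂.hasSum_range_iff).2 s₂.hasSum
  have t₃ := (i₃.hasSum_range_iff).2 (hX.comp_injective i₃).hasSum
  rw [r₁] at t₁
  rw [r₂] at t₂
  rw [r₃] at t₃
  have t₁₂ := HasSum.add_disjoint (s := {p : ℕ × ℕ | p.1 < p.2}) (t := {p | p.2 < p.1})
    (Set.disjoint_left.2 fun p (h : p.1 < p.2) (h' : p.2 < p.1) => lt_asymm h h') t₁ t₂
  have t := HasSum.add_isCompl (s := {p : ℕ × ℕ | p.1 < p.2} ∪ {p | p.2 < p.1})
    (t := {p | p.1 = p.2}) ?_ t₁₂ t₃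
  · have hv : ∑' p, X p - ∑' i, X (i, i) = 2 * ∑' p, (X ∘ e₂) p := by
      rw [t.tsum_eq, heq]
      simp only [Function.comp_def, e₃]
      ring
    rw [hv, s₂.tsum_prod]
    exact s₂.prod.hasSum.mul_left 2
  · rw [isCompl_iff, Set.disjoint_left, codisjoint_iff]
    refine ⟨fun p hp (h : p.1 = p.2) => ?_, ?_⟩
    · simp only [Set.mem_union, Set.mem_ofPred_eq] at hp
      omega
    · ext p
      simp only [Set.sup_eq_union, Set.mem_union, Set.mem_ofPred_eq, Set.top_eq_univ, Set.mem_univ,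
        iff_true]
      omega

end Tsum

section Coefficients

variable {q : ℝ}

lemma one_sub_pow_ne_zero (hq : |q| < 1) {n : ℕ} (hn : n ≠ 0) : 1 - q ^ n ≠ 0 := by
  have : |q ^ n| < 1 := by rw [abs_pow]; exact pow_lt_one₀ (abs_nonneg q) hq hn
  linarith [(abs_lt.1 this).2]

lemma abs_lambertU_le (hq : |q| < 1) (n : ℕ) : |lambertU q n| ≤ (1 - |q|)⁻¹ := by
  have hpos : 0 < 1 - |q| := by linarith
  rcases eq_or_ne n 0 with rfl | hn
  · simpa using hq.le
  · rw [lambertU, abs_inv]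
    refine inv_anti₀ hpos ((?_ : 1 - |q| ≤ 1 - q ^ n).trans (le_abs_self _))
    have h1 : |q| ^ n ≤ |q| := pow_le_of_le_one (abs_nonneg q) hq.le hn
    have h2 : q ^ n ≤ |q| ^ n := by rw [← abs_pow]; exact le_abs_self _
    linarith

lemma abs_lambertA_le (hq : |q| < 1) (n : ℕ) : |lambertA q n| ≤ (1 - |q|)⁻¹ * |q| ^ n := by
  rw [lambertA, abs_mul, abs_pow, mul_comm]
  gcongr
  exact abs_lambertU_le hq n

lemma abs_lambertSum_le (hq : |q| < 1) (n : ℕ) : |lambertSum q n| ≤ (1 - |q|)⁻¹ * n := by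
  have hpos : 0 < 1 - |q| := by linarith
  refine (Finset.abs_sum_le_sum_abs _ _).trans ?_
  calc ∑ i ∈ Finset.range n, |lambertA q i| ≤ ∑ i ∈ Finset.range n, (1 - |q|)⁻¹ := by
        refine Finset.sum_le_sum fun i _ => (abs_lambertA_le hq i).trans ?_
        exact mul_le_of_le_one_right (by positivity) (pow_le_one₀ (abs_nonneg q) hq.le)
    _ = _ := by simp [mul_comm]

lemma summable_lambertA (hq : |q| < 1) : Summable (lambertA q) :=
  Summable.of_norm_bounded
    ((summable_geometric_of_lt_one (abs_nonneg q) hq).mul_left _) (abs_lambertA_le hq)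

lemma lambertU_eq (hq : |q| < 1) {n : ℕ} (hn : n ≠ 0) : lambertU q n = 1 + lambertA q n := by
  have := one_sub_pow_ne_zero hq hn
  rw [lambertA, lambertU]
  field_simp
  ring

lemma lambertU_mul (hq : |q| < 1) {i j : ℕ} (hi : i ≠ 0) (hj : j ≠ 0) :
    lambertU q i * lambertU q j = lambertU q (i + j) * (1 + lambertA q i + lambertA q j) := by
  have h1 := one_sub_pow_ne_zero hq hi
  have h2 := one_sub_pow_ne_zero hq hj
  have h3 := one_sub_pow_ne_zero hq (n := i + j) (by omega)
  rw [pow_add] at h3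
  simp only [lambertA, lambertU, pow_add]
  field_simp
  ring

lemma lambertA_mul_lambertU_add (hq : |q| < 1) {k n : ℕ} (hk : k ≠ 0) (hn : n ≠ 0) :
    lambertA q k * lambertU q (k + n) = lambertU q n * (lambertA q k - lambertA q (k + n)) := by
  have h1 := one_sub_pow_ne_zero hq hk
  have h2 := one_sub_pow_ne_zero hq hn
  have h3 := one_sub_pow_ne_zero hq (n := k + n) (by omega)
  rw [pow_add] at h3
  simp only [lambertA, lambertU, pow_add]
  field_simp
  ring

lemma sum_antidiagonal_lambertU (hq : |q| < 1) (n : ℕ) :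
    ∑ p ∈ Finset.HasAntidiagonal.antidiagonal n, lambertU q p.1 * lambertU q p.2 =
      lambertU q n * (n - 1 + 2 * lambertSum q n) := by
  rw [Finset.Nat.sum_antidiagonal_eq_sum_range_succ (fun i j => lambertU q i * lambertU q j)]
  cases n with
  | zero => simp
  | succ m =>
    rw [Finset.sum_range_succ, Finset.sum_range_succ']
    have h : ∀ i ∈ Finset.range m, lambertU q (i + 1) * lambertU q (m + 1 - (i + 1)) =
        lambertU q (m + 1) *
          (1 + lambertA q (i + 1) + lambertA q (m - 1 - i + 1)) := fun i hi => by
      have hi := Finset.mem_range.1 hi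
      rw [lambertU_mul hq (by omega) (by omega), show i + 1 + (m + 1 - (i + 1)) = m + 1 by omega,
        show m + 1 - (i + 1) = m - 1 - i + 1 by omega]
    rw [Finset.sum_congr rfl h, ← Finset.mul_sum, Finset.sum_add_distrib, Finset.sum_add_distrib,
      Finset.sum_range_reflect (fun i => lambertA q (i + 1)), lambertSum, Finset.sum_range_succ']
    simp [-mul_eq_mul_left_iff]
    ring

lemma sum_antidiagonal_lambertA (hq : |q| < 1) (n : ℕ) :
    ∑ p ∈ Finset.HasAntidiagonal.antidiagonal n, lambertA q p.1 * lambertA q p.2 =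
      lambertA q n * (n - 1 + 2 * lambertSum q n) := by
  rw [lambertA, mul_assoc, ← sum_antidiagonal_lambertU hq, Finset.mul_sum]
  refine Finset.sum_congr rfl fun p hp => ?_
  rw [← Finset.HasAntidiagonal.mem_antidiagonal.1 hp, pow_add, lambertA, lambertA]
  ring

lemma tsum_lambertA_add (hq : |q| < 1) (n : ℕ) :
    ∑' k, lambertA q (k + n) = ∑' k, lambertA q k - lambertSum q n := by
  rw [← (summable_lambertA hq).sum_add_tsum_nat_add n, lambertSum]
  ring

lemma tsum_lambertA_mul_lambertU_add (hq : |q| < 1) {n : ℕ} (hn : n ≠ 0) :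
    ∑' k, lambertA q k * lambertU q (k + n) = lambertU q n * lambertSum q (n + 1) := by
  have hs := summable_lambertA hq
  rw [← tsum_add_eq_tsum 1 (by simp)]
  simp_rw [lambertA_mul_lambertU_add hq (Nat.add_one_ne_zero _) hn]
  rw [tsum_mul_left, Summable.tsum_sub ((summable_nat_add_iff 1).2 hs)
    (by simpa only [add_assoc] using (summable_nat_add_iff (1 + n)).2 hs)]
  simp_rw [add_assoc]
  rw [tsum_lambertA_add hq, tsum_lambertA_add hq, add_comm 1 n]
  simp [lambertSum]

lemma tsum_lambertA_mul_lambertA_add (hq : |q| < 1) {n : ℕ} (hn : n ≠ 0) :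
    ∑' k, lambertA q k * lambertA q (k + n) =
      lambertU q n * lambertSum q (n + 1) - ∑' k, lambertA q k := by
  have hs := summable_lambertA hq
  have hs' : Summable fun k => lambertA q k * lambertU q (k + n) := by
    refine Summable.of_norm_bounded (hs.abs.mul_right (1 - |q|)⁻¹) fun k => ?_
    rw [norm_mul]
    exact mul_le_mul_of_nonneg_left (abs_lambertU_le hq _) (abs_nonneg _)
  rw [← tsum_lambertA_mul_lambertU_add hq hn, ← hs'.tsum_sub hs]
  refine tsum_congr fun k => ?_
  rw [lambertU_eq hq (by omega : k + n ≠ 0)]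
  ring

end Coefficients

section QuadraticSums

variable {q : ℝ}

lemma hasSum_antidiagonal_lambertU (hq : |q| < 1) {g : ℕ → ℝ} {K : ℝ}
    (hg : ∀ n, |g n| ≤ K * (n + 1)) :
    HasSum (fun n => lambertA q n * g n * (lambertU q n * (n - 1 + 2 * lambertSum q n)))
      (∑' i, ∑' j, lambertU q i * lambertU q j * (lambertA q (i + j) * g (i + j))) := by
  let F : ℕ × ℕ → ℝ := fun p =>
    lambertU q p.1 * lambertU q p.2 * (lambertA q (p.1 + p.2) * g (p.1 + p.2))
  have hpos : 0 < 1 - |q| := by linarith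
  have hK : 0 ≤ K := by simpa using (abs_nonneg _).trans (hg 0)
  have hF : Summable F := by
    refine summable_pair_of_le (K := (1 - |q|)⁻¹ * (1 - |q|)⁻¹ * ((1 - |q|)⁻¹ * K)) 1
      (abs_nonneg q) hq fun i j => ?_
    calc |F (i, j)| = |lambertU q i| * |lambertU q j| * (|lambertA q (i + j)| * |g (i + j)|) := by
          simp only [F, abs_mul]
      _ ≤ (1 - |q|)⁻¹ * (1 - |q|)⁻¹ *
          ((1 - |q|)⁻¹ * |q| ^ (i + j) * (K * (((i : ℝ) + 1) * ((j : ℝ) + 1)))) := by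
          gcongr
          · exact abs_lambertU_le hq i
          · exact abs_lambertU_le hq j
          · exact abs_lambertA_le hq _
          · refine (hg _).trans (mul_le_mul_of_nonneg_left ?_ hK)
            push_cast
            nlinarith [mul_nonneg (Nat.cast_nonneg (α := ℝ) i) (Nat.cast_nonneg (α := ℝ) j)]
      _ = _ := by ring
  have h := hasSum_antidiagonal hF
  rw [hF.tsum_prod] at h
  convert! h using 2 with n
  rw [← sum_antidiagonal_lambertU hq, Finset.mul_sum]
  refine Finset.sum_congr rfl fun p hp => ?_
  simp only [F, Finset.HasAntidiagonal.mem_antidiagonal.1 hp]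
  ring

/-- The four-fold sum with its last index eliminated. -/
noncomputable def quadTerm (q : ℝ) (i j k : ℕ) : ℝ :=
  if k ≤ i + j then
    q ^ (i + j) * lambertU q i * lambertU q j * lambertU q k * lambertU q (i + j - k)
  else 0

lemma abs_quadTerm_le (hq : |q| < 1) (i j k : ℕ) :
    |quadTerm q i j k| ≤ (1 - |q|)⁻¹ ^ 4 * (√|q| ^ i * √|q| ^ j * √|q| ^ k) := by
  have hpos : 0 < 1 - |q| := by linarith
  have hs : √|q| ≤ 1 := by simpa using hq.le
  rw [quadTerm]
  split_ifs with h
  · simp only [abs_mul, abs_pow]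
    have h1 : |q| ^ (i + j) ≤ √|q| ^ i * √|q| ^ j * √|q| ^ k := by
      rw [← pow_add, ← pow_add]
      calc |q| ^ (i + j) = √|q| ^ (2 * (i + j)) := by rw [pow_mul, Real.sq_sqrt (abs_nonneg q)]
        _ ≤ _ := pow_le_pow_of_le_one (Real.sqrt_nonneg _) hs (by omega)
    calc |q| ^ (i + j) * |lambertU q i| * |lambertU q j| * |lambertU q k| * |lambertU q (i + j - k)|
        ≤ (√|q| ^ i * √|q| ^ j * √|q| ^ k) * (1 - |q|)⁻¹ * (1 - |q|)⁻¹ * (1 - |q|)⁻¹ *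
          (1 - |q|)⁻¹ := by
          gcongr <;> exact abs_lambertU_le hq _
      _ = _ := by ring
  · rw [abs_zero]
    positivity

lemma sqrt_abs_lt_one (hq : |q| < 1) : √|q| < 1 := by
  rw [Real.sqrt_lt' one_pos]; simpa using hq

lemma summable_quadTerm_right (hq : |q| < 1) (i : ℕ) :
    Summable fun p : ℕ × ℕ => quadTerm q i p.1 p.2 := by
  refine summable_pair_of_le (K := (1 - |q|)⁻¹ ^ 4 * √|q| ^ i) 0 (Real.sqrt_nonneg _)
    (sqrt_abs_lt_one hq) fun j k => (abs_quadTerm_le hq i j k).trans (le_of_eq ?_)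
  ring

lemma summable_tsum_quadTerm (hq : |q| < 1) :
    Summable fun p : ℕ × ℕ => ∑' j, quadTerm q p.1 j p.2 := by
  have hs := sqrt_abs_lt_one hq
  have hpos : 0 < 1 - |q| := by linarith
  have hg := summable_geometric_of_lt_one (Real.sqrt_nonneg |q|) hs
  refine summable_pair_of_le (K := (1 - |q|)⁻¹ ^ 4 * ∑' j, √|q| ^ j) 0 (Real.sqrt_nonneg _)
    hs fun i k => ?_
  have hb := hg.mul_left ((1 - |q|)⁻¹ ^ 4 * (√|q| ^ i * √|q| ^ k))
  refine (tsum_of_norm_bounded (f := fun j => quadTerm q i j k) hb.hasSum fun j =>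
    (abs_quadTerm_le hq i j k).trans (le_of_eq ?_)).trans (le_of_eq ?_)
  · ring
  · rw [tsum_mul_left]
    ring

lemma tsum_quadTerm_last (i j : ℕ) :
    ∑' k, quadTerm q i j k = q ^ (i + j) * lambertU q i * lambertU q j *
      ∑ p ∈ Finset.HasAntidiagonal.antidiagonal (i + j), lambertU q p.1 * lambertU q p.2 := by
  rw [Finset.Nat.sum_antidiagonal_eq_sum_range_succ (fun i j => lambertU q i * lambertU q j),
    tsum_eq_sum (s := Finset.range (i + j).succ), Finset.mul_sum]
  · refine Finset.sum_congr rfl fun k hk => ?_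
    rw [quadTerm, if_pos (Nat.lt_succ_iff.1 (Finset.mem_range.1 hk))]
    ring
  · intro k hk
    rw [quadTerm, if_neg]
    simpa [Nat.lt_succ_iff] using hk

lemma tsum_quadTerm_diagonal (i : ℕ) :
    ∑' j, quadTerm q i j i =
      lambertA q i * lambertU q i * ∑' j, lambertA q j * lambertU q j := by
  rw [← tsum_mul_left]
  refine tsum_congr fun j => ?_
  rw [quadTerm, if_pos (by omega), Nat.add_sub_cancel_left, pow_add, lambertA, lambertA]
  ring

lemma tsum_quadTerm_below (hq : |q| < 1) (i d : ℕ) :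
    ∑' j, quadTerm q (i + d + 1) j i = lambertU q i * lambertA q (i + (d + 1)) *
      (lambertU q (d + 1) * lambertSum q (d + 1 + 1)) := by
  rw [← tsum_lambertA_mul_lambertU_add hq (Nat.add_one_ne_zero d), ← tsum_mul_left]
  refine tsum_congr fun j => ?_
  rw [quadTerm, if_pos (by omega), show i + d + 1 + j - i = j + (d + 1) by omega, pow_add,
    lambertA, lambertA, ← add_assoc i]
  ring

lemma tsum_quadTerm_above (hq : |q| < 1) (i d : ℕ) :
    ∑' j, quadTerm q i j (i + d + 1) = lambertU q i * lambertA q (i + (d + 1)) *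
      (lambertU q (d + 1) * lambertSum q (d + 1 + 1)) := by
  rw [← tsum_lambertA_mul_lambertU_add hq (Nat.add_one_ne_zero d), ← tsum_mul_left,
    ← tsum_add_eq_tsum (d + 1)]
  · refine tsum_congr fun j => ?_
    rw [quadTerm, if_pos (by omega), show i + (j + (d + 1)) - (i + d + 1) = j by omega,
      lambertA, lambertA, add_assoc i d 1]
    ring
  · intro j hj
    rw [quadTerm, if_neg (by omega)]

lemma tsum_lambertU_mul_lambertA_add (hq : |q| < 1) {n : ℕ} (hn : n ≠ 0) :
    ∑' k, lambertU q k * lambertA q (k + n) = lambertA q n * lambertSum q (n + 1) := by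
  rw [lambertA, mul_assoc, ← tsum_lambertA_mul_lambertU_add hq hn, ← tsum_mul_left]
  refine tsum_congr fun k => ?_
  rw [lambertA, lambertA, pow_add]
  ring

lemma hasSum_quadTerm_antidiagonal (hq : |q| < 1) :
    HasSum (fun n : ℕ => lambertA q n * lambertU q n * (n - 1 + 2 * lambertSum q n) ^ 2)
      (∑' i, ∑' j, ∑' k, quadTerm q i j k) := by
  have hpos : 0 < 1 - |q| := by linarith
  have h := hasSum_antidiagonal_lambertU hq (K := 1 + 2 * (1 - |q|)⁻¹)
    (g := fun n => n - 1 + 2 * lambertSum q n) fun n => by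
      have h1 : |(n : ℝ) - 1| ≤ n + 1 := by
        rw [abs_le]
        constructor <;> linarith [Nat.cast_nonneg (α := ℝ) n]
      have h2 := abs_lambertSum_le hq n
      have h3 := abs_add_le ((n : ℝ) - 1) (2 * lambertSum q n)
      rw [abs_mul, abs_two] at h3
      nlinarith [inv_pos.2 hpos]
  convert! h using 1
  · ext n
    ring
  · refine tsum_congr fun i => tsum_congr fun j => ?_
    rw [tsum_quadTerm_last, sum_antidiagonal_lambertU hq, lambertA]
    ring

lemma hasSum_quadTerm_split (hq : |q| < 1) :
    HasSum (fun n : ℕ => 2 * (lambertA q n * lambertU q n * lambertSum q (n + 1) ^ 2))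
      (∑' i, ∑' j, ∑' k, quadTerm q i j k - (∑' n, lambertA q n * lambertU q n) ^ 2) := by
  have h := hasSum_split_diagonal (summable_tsum_quadTerm hq) fun i d => by
    rw [tsum_quadTerm_above hq, tsum_quadTerm_below hq]
  simp only [tsum_quadTerm_below hq, tsum_quadTerm_diagonal] at h
  simp only [tsum_mul_right, tsum_lambertU_mul_lambertA_add hq (Nat.add_one_ne_zero _)] at h
  rw [(summable_tsum_quadTerm hq).tsum_prod] at h
  have h' : ∀ i, ∑' k, ∑' j, quadTerm q i j k = ∑' j, ∑' k, quadTerm q i j k := fun i =>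
    Summable.tsum_comm (summable_quadTerm_right hq i)
  simp only [h'] at h
  rw [← hasSum_nat_add_iff' 1]
  simp only [Finset.sum_range_one, lambertA_zero, zero_mul, mul_zero, sub_zero]
  convert! h using 1
  · ext d
    ring
  · rw [sq]

lemma hasSum_tripleTerm (hq : |q| < 1) :
    HasSum (fun n : ℕ => lambertA q n * lambertU q n * lambertSum q (n + 1) *
        (n - 1 + 2 * lambertSum q n))
      (∑' i, ∑' j, ∑' k, q ^ (i + j + k) * lambertU q i * lambertU q j * lambertU q k *
        lambertU q (i + j + k)) := by
  have h := hasSum_antidiagonal_lambertU hq (g := fun n => lambertSum q (n + 1)) fun n => by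
    simpa using abs_lambertSum_le hq (n + 1)
  convert! h using 1
  · ext n
    ring
  · refine tsum_congr fun i => tsum_congr fun j => ?_
    rcases eq_or_ne (i + j) 0 with h0 | h0
    · obtain ⟨rfl, rfl⟩ : i = 0 ∧ j = 0 := by omega
      simp
    · rw [← tsum_lambertU_mul_lambertA_add hq h0, ← tsum_mul_left]
      refine tsum_congr fun k => ?_
      rw [lambertA, add_comm k]
      ring

end QuadraticSums

section Duality

variable {q : ℝ}

lemma hasSum_succ_mul_geometric {x : ℝ} (hx : |x| < 1) :
    HasSum (fun m : ℕ => ((m : ℝ) + 1) * x ^ (m + 1)) (x / (1 - x) ^ 2) := by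
  have h := (hasSum_choose_mul_geometric_of_norm_lt_one 1 hx).mul_left x
  convert! h using 1
  · ext m
    rw [Nat.choose_one_right]
    push_cast
    ring
  · ring

lemma hasSum_succ_sq_mul_geometric {x : ℝ} (hx : |x| < 1) :
    HasSum (fun m : ℕ => ((m : ℝ) + 1) ^ 2 * x ^ (m + 1)) (x * (1 + x) / (1 - x) ^ 3) := by
  have h := ((hasSum_choose_mul_geometric_of_norm_lt_one 2 hx).mul_left (2 * x)).sub
    (hasSum_succ_mul_geometric hx)
  have hx' : 1 - x ≠ 0 := by linarith [(abs_lt.1 hx).2]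
  convert! h using 1
  · ext m
    rw [Nat.cast_choose_two]
    push_cast
    ring
  · field_simp
    ring

lemma cast_choose_three (m : ℕ) :
    ((m + 3).choose 3 : ℝ) = ((m : ℝ) + 1) * (m + 2) * (m + 3) / 6 := by
  induction m with
  | zero => norm_num
  | succ m ih =>
    rw [show m + 1 + 3 = m + 3 + 1 by ring, Nat.choose_succ_succ']
    push_cast
    rw [ih, Nat.cast_choose_two]
    push_cast
    ring

lemma hasSum_succ_cube_mul_geometric {x : ℝ} (hx : |x| < 1) :
    HasSum (fun m : ℕ => ((m : ℝ) + 1) ^ 3 * x ^ (m + 1))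
      (x * (1 + 4 * x + x ^ 2) / (1 - x) ^ 4) := by
  have h := (((hasSum_choose_mul_geometric_of_norm_lt_one 3 hx).mul_left (6 * x)).sub
    ((hasSum_succ_sq_mul_geometric hx).mul_left 3)).sub
    ((hasSum_succ_mul_geometric hx).mul_left 2)
  have hx' : 1 - x ≠ 0 := by linarith [(abs_lt.1 hx).2]
  convert! h using 1
  · ext m
    rw [cast_choose_three]
    ring
  · field_simp
    ring

lemma hasSum_nat_of_succ {f : ℕ → ℝ} {s : ℝ} (h0 : f 0 = 0) (h : HasSum (fun n => f (n + 1)) s) :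
    HasSum f s := by
  rw [← hasSum_nat_add_iff' 1]
  simpa [h0] using h

/-- If `a (qⁿ) = ∑_m m^β q^{nm}` and `b (qᵐ) = ∑_n n^α q^{nm}`, then
`∑_n n^α a (qⁿ) = ∑_m m^β b (qᵐ)`. -/
lemma exists_hasSum_lambert_duality (hq : |q| < 1) (α β : ℕ) {a b : ℕ → ℝ}
    (ha : ∀ n : ℕ, HasSum (fun m : ℕ => ((m : ℝ) + 1) ^ β * (q ^ (n + 1)) ^ (m + 1)) (a (n + 1)))
    (hb : ∀ m : ℕ, HasSum (fun n : ℕ => ((n : ℝ) + 1) ^ α * (q ^ (m + 1)) ^ (n + 1)) (b (m + 1)))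
    (ha0 : a 0 = 0) (hb0 : b 0 = 0) :
    ∃ s, HasSum (fun n : ℕ => (n : ℝ) ^ α * a n) s ∧ HasSum (fun n : ℕ => (n : ℝ) ^ β * b n) s := by
  let F : ℕ × ℕ → ℝ := fun p =>
    ((p.1 : ℝ) + 1) ^ α * (((p.2 : ℝ) + 1) ^ β * q ^ ((p.1 + 1) * (p.2 + 1)))
  have hF : Summable F := by
    refine summable_pair_of_le (K := 1) (α + β) (abs_nonneg q) hq fun i j => ?_
    have hi : (1 : ℝ) ≤ (i : ℝ) + 1 := by linarith [Nat.cast_nonneg (α := ℝ) i]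
    have hj : (1 : ℝ) ≤ (j : ℝ) + 1 := by linarith [Nat.cast_nonneg (α := ℝ) j]
    calc |F (i, j)| = ((i : ℝ) + 1) ^ α * (((j : ℝ) + 1) ^ β * |q| ^ ((i + 1) * (j + 1))) := by
          simp only [F, abs_mul, abs_pow]
          rw [abs_of_nonneg (by positivity : (0 : ℝ) ≤ (i : ℝ) + 1),
            abs_of_nonneg (by positivity : (0 : ℝ) ≤ (j : ℝ) + 1)]
      _ ≤ ((i : ℝ) + 1) ^ (α + β) * (((j : ℝ) + 1) ^ (α + β) * |q| ^ (i + j)) := by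
          gcongr ?_ * (?_ * ?_)
          · exact pow_le_pow_right₀ hi (by omega)
          · exact pow_le_pow_right₀ hj (by omega)
          · exact pow_le_pow_of_le_one (abs_nonneg q) hq.le (by nlinarith)
      _ = _ := by ring
  refine ⟨∑' p, F p, hasSum_nat_of_succ (by simp [ha0]) ?_, hasSum_nat_of_succ (by simp [hb0]) ?_⟩
  · refine hF.hasSum.prod_fiberwise fun n => ?_
    convert! (ha n).mul_left (((n : ℝ) + 1) ^ α) using 1
    · ext m
      simp only [F, pow_mul]
    · push_cast
      ring
  · refine ((Equiv.prodComm ℕ ℕ).hasSum_iff.2 hF.hasSum).prod_fiberwise fun m => ?_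
    convert! (hb m).mul_left (((m : ℝ) + 1) ^ β) using 1
    · ext n
      simp only [F, Function.comp_apply, Equiv.prodComm_apply, Prod.swap, ← pow_mul]
      ring
    · push_cast
      ring

lemma abs_pow_succ_lt_one (hq : |q| < 1) (n : ℕ) : |q ^ (n + 1)| < 1 := by
  rw [abs_pow]
  exact pow_lt_one₀ (abs_nonneg q) hq (Nat.add_one_ne_zero n)

lemma hasSum_lambertA (hq : |q| < 1) (n : ℕ) :
    HasSum (fun m : ℕ => ((m : ℝ) + 1) ^ 0 * (q ^ (n + 1)) ^ (m + 1)) (lambertA q (n + 1)) := by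
  convert! (hasSum_geometric_of_abs_lt_one (abs_pow_succ_lt_one hq n)).mul_left (q ^ (n + 1))
    using 1
  ext m
  ring

lemma hasSum_lambertA_mul_lambertU (hq : |q| < 1) (n : ℕ) :
    HasSum (fun m : ℕ => ((m : ℝ) + 1) ^ 1 * (q ^ (n + 1)) ^ (m + 1))
      (lambertA q (n + 1) * lambertU q (n + 1)) := by
  convert! hasSum_succ_mul_geometric (abs_pow_succ_lt_one hq n) using 1
  · ext m
    rw [pow_one]
  · rw [lambertA, lambertU, div_eq_mul_inv, sq, mul_inv, mul_assoc]

lemma hasSum_lambert_sq (hq : |q| < 1) (n : ℕ) :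
    HasSum (fun m : ℕ => ((m : ℝ) + 1) ^ 2 * (q ^ (n + 1)) ^ (m + 1))
      (lambertA q (n + 1) * lambertU q (n + 1) * (1 + 2 * lambertA q (n + 1))) := by
  convert! hasSum_succ_sq_mul_geometric (abs_pow_succ_lt_one hq n) using 1
  have := one_sub_pow_ne_zero hq (Nat.add_one_ne_zero n)
  rw [lambertA, lambertU]
  field_simp
  ring

lemma hasSum_lambert_cube (hq : |q| < 1) (n : ℕ) :
    HasSum (fun m : ℕ => ((m : ℝ) + 1) ^ 3 * (q ^ (n + 1)) ^ (m + 1))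
      (lambertA q (n + 1) * lambertU q (n + 1) +
        6 * (lambertA q (n + 1) * lambertU q (n + 1)) ^ 2) := by
  convert! hasSum_succ_cube_mul_geometric (abs_pow_succ_lt_one hq n) using 1
  have := one_sub_pow_ne_zero hq (Nat.add_one_ne_zero n)
  rw [lambertA, lambertU]
  field_simp
  ring

lemma hasSum_mul_lambertA (hq : |q| < 1) :
    HasSum (fun n : ℕ => n * lambertA q n) (∑' n, lambertA q n * lambertU q n) := by
  obtain ⟨s, h1, h2⟩ := exists_hasSum_lambert_duality hq 1 0 (a := lambertA q)
    (b := fun n => lambertA q n * lambertU q n) (hasSum_lambertA hq)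
    (hasSum_lambertA_mul_lambertU hq) (by simp) (by simp)
  simp only [pow_one, pow_zero, one_mul] at h1 h2
  rwa [h2.tsum_eq]

lemma summable_lambertA_mul_lambertU (hq : |q| < 1) :
    Summable fun n => lambertA q n * lambertU q n :=
  Summable.of_norm_bounded ((summable_lambertA hq).abs.mul_right (1 - |q|)⁻¹) fun n => by
    rw [norm_mul]
    exact mul_le_mul_of_nonneg_left (abs_lambertU_le hq _) (abs_nonneg _)

lemma summable_lambertA_mul_lambertU_sq (hq : |q| < 1) :
    Summable fun n => (lambertA q n * lambertU q n) ^ 2 := by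
  obtain ⟨s, -, h⟩ := exists_hasSum_lambert_duality hq 3 0 (a := lambertA q)
    (b := fun n => lambertA q n * lambertU q n + 6 * (lambertA q n * lambertU q n) ^ 2)
    (hasSum_lambertA hq) (hasSum_lambert_cube hq) (by simp) (by simp)
  convert! (h.summable.sub (summable_lambertA_mul_lambertU hq)).mul_left (1 / 6) using 2 with n
  ring

lemma hasSum_cube_mul_lambertA (hq : |q| < 1) :
    HasSum (fun n : ℕ => (n : ℝ) ^ 3 * lambertA q n)
      (∑' n, lambertA q n * lambertU q n + 6 * ∑' n, (lambertA q n * lambertU q n) ^ 2) := by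
  obtain ⟨s, h1, h2⟩ := exists_hasSum_lambert_duality hq 3 0 (a := lambertA q)
    (b := fun n => lambertA q n * lambertU q n + 6 * (lambertA q n * lambertU q n) ^ 2)
    (hasSum_lambertA hq) (hasSum_lambert_cube hq) (by simp) (by simp)
  simp only [pow_zero, one_mul] at h2
  have h3 := (summable_lambertA_mul_lambertU hq).hasSum.add
    ((summable_lambertA_mul_lambertU_sq hq).hasSum.mul_left 6)
  rwa [h2.unique h3] at h1

lemma exists_hasSum_sq_mul (hq : |q| < 1) :
    ∃ s, HasSum (fun n : ℕ => (n : ℝ) ^ 2 * (lambertA q n * lambertU q n)) s ∧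
      HasSum (fun n : ℕ => n * (lambertA q n * lambertU q n * (1 + 2 * lambertA q n))) s := by
  obtain ⟨s, h1, h2⟩ := exists_hasSum_lambert_duality hq 2 1
    (a := fun n => lambertA q n * lambertU q n)
    (b := fun n => lambertA q n * lambertU q n * (1 + 2 * lambertA q n))
    (hasSum_lambertA_mul_lambertU hq) (hasSum_lambert_sq hq) (by simp) (by simp)
  simp only [pow_one] at h2
  exact ⟨s, h1, h2⟩

end Duality

section Ramanujan

variable {q : ℝ}

lemma summable_lambertA_mul_lambertA_mul (hq : |q| < 1) {c : ℕ → ℕ → ℝ}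
    (hc : ∀ i j : ℕ, |c i j| ≤ ((i : ℝ) + j) ^ 2) :
    Summable fun p : ℕ × ℕ => lambertA q p.1 * lambertA q p.2 * c p.1 p.2 := by
  have hpos : 0 < 1 - |q| := by linarith
  refine summable_pair_of_le (K := (1 - |q|)⁻¹ ^ 2) 2 (abs_nonneg q) hq fun i j => ?_
  simp only [abs_mul]
  calc |lambertA q i| * |lambertA q j| * |c i j|
      ≤ (1 - |q|)⁻¹ * |q| ^ i * ((1 - |q|)⁻¹ * |q| ^ j) * (((i : ℝ) + 1) * ((j : ℝ) + 1)) ^ 2 := by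
        gcongr
        · exact abs_lambertA_le hq i
        · exact abs_lambertA_le hq j
        · refine (hc i j).trans (pow_le_pow_left₀ (by positivity) ?_ 2)
          nlinarith [mul_nonneg (Nat.cast_nonneg (α := ℝ) i) (Nat.cast_nonneg (α := ℝ) j)]
    _ = _ := by ring

lemma hasSum_lambertA_mul_add_sq (hq : |q| < 1) :
    HasSum (fun n : ℕ => (n : ℝ) ^ 2 * (lambertA q n * (n - 1 + 2 * lambertSum q n)))
      (∑' p : ℕ × ℕ, lambertA q p.1 * lambertA q p.2 * ((p.1 : ℝ) + p.2) ^ 2) := by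
  convert! hasSum_antidiagonal (summable_lambertA_mul_lambertA_mul hq
    (c := fun i j => ((i : ℝ) + j) ^ 2) fun i j => (abs_of_nonneg (by positivity)).le) using 1
  ext n
  rw [← sum_antidiagonal_lambertA hq, Finset.mul_sum]
  refine Finset.sum_congr rfl fun p hp => ?_
  rw [← Finset.HasAntidiagonal.mem_antidiagonal.1 hp]
  push_cast
  ring

lemma summable_lambertA_mul_sub_sq (hq : |q| < 1) :
    Summable fun p : ℕ × ℕ => lambertA q p.1 * lambertA q p.2 * ((p.1 : ℝ) - p.2) ^ 2 := by
  refine summable_lambertA_mul_lambertA_mul hq (c := fun i j => ((i : ℝ) - j) ^ 2) fun i j => ?_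
  rw [abs_of_nonneg (by positivity)]
  nlinarith [mul_nonneg (Nat.cast_nonneg (α := ℝ) i) (Nat.cast_nonneg (α := ℝ) j)]

lemma hasSum_lambertA_mul_sub_sq (hq : |q| < 1) :
    HasSum (fun n : ℕ => 2 * ((n : ℝ) ^ 2 *
        (lambertU q n * lambertSum q (n + 1) - ∑' k, lambertA q k)))
      (∑' p : ℕ × ℕ, lambertA q p.1 * lambertA q p.2 * ((p.1 : ℝ) - p.2) ^ 2) := by
  have h := hasSum_split_diagonal (summable_lambertA_mul_sub_sq hq) fun i d => by
    push_cast
    ring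
  simp only [sub_self, ne_eq, OfNat.ofNat_ne_zero, not_false_eq_true, zero_pow, mul_zero, tsum_zero,
    sub_zero] at h
  refine hasSum_nat_of_succ (by simp) ?_
  convert! h using 1
  ext d
  rw [← tsum_lambertA_mul_lambertA_add hq (Nat.add_one_ne_zero d), ← tsum_mul_left]
  congr 1
  refine tsum_congr fun i => ?_
  rw [add_assoc i]
  push_cast
  ring

lemma sum_range_sq (n : ℕ) :
    ∑ i ∈ Finset.range n, (i : ℝ) ^ 2 = ((n : ℝ) - 1) * n * (2 * n - 1) / 6 := by
  induction n with
  | zero => simp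
  | succ n ih =>
    rw [Finset.sum_range_succ, ih]
    push_cast
    ring

lemma exists_hasSum_sq_mul_tail (hq : |q| < 1) :
    ∃ s, HasSum (fun n : ℕ => (n : ℝ) ^ 2 * (∑' k, lambertA q k - lambertSum q (n + 1))) s ∧
      HasSum (fun n : ℕ => lambertA q n * (((n : ℝ) - 1) * n * (2 * n - 1) / 6)) s := by
  have hpos : 0 < 1 - |q| := by linarith
  let F : ℕ × ℕ → ℝ := fun p => (p.1 : ℝ) ^ 2 * lambertA q (p.2 + (p.1 + 1))
  have hF : Summable F := by
    refine summable_pair_of_le (K := (1 - |q|)⁻¹) 2 (abs_nonneg q) hq fun i j => ?_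
    calc |F (i, j)| = (i : ℝ) ^ 2 * |lambertA q (j + (i + 1))| := by
          simp only [F, abs_mul, abs_pow, Nat.abs_cast]
      _ ≤ ((i : ℝ) + 1) ^ 2 * ((1 - |q|)⁻¹ * |q| ^ (i + j)) := by
          gcongr
          · linarith
          · refine (abs_lambertA_le hq _).trans ?_
            gcongr ?_ * ?_
            exact pow_le_pow_of_le_one (abs_nonneg q) hq.le (by omega)
      _ = (1 - |q|)⁻¹ * ((((i : ℝ) + 1) ^ 2 * |q| ^ i) * (1 * |q| ^ j)) := by ring
      _ ≤ _ := by
          gcongr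
          exact one_le_pow₀ (by linarith [Nat.cast_nonneg (α := ℝ) j])
  refine ⟨∑' p, F p, ?_, hasSum_nat_of_succ (by simp) ?_⟩
  · convert! hF.prod.hasSum using 1
    · ext n
      rw [← tsum_lambertA_add hq, ← tsum_mul_left]
    · exact hF.tsum_prod
  · convert! hasSum_antidiagonal hF using 1
    ext n
    rw [← sum_range_sq, Finset.mul_sum, Finset.Nat.sum_antidiagonal_eq_sum_range_succ_mk]
    refine Finset.sum_congr rfl fun i hi => ?_
    have := Finset.mem_range.1 hi
    simp only [F, show n - i + (i + 1) = n + 1 by omega]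
    ring

/-- The series form of Ramanujan's differential equation for the Eisenstein series of weight 2. -/
lemma hasSum_four_mul_sq (hq : |q| < 1) :
    HasSum (fun n : ℕ => 5 / 3 * ((n : ℝ) ^ 3 * lambertA q n) + 1 / 3 * (n * lambertA q n)
        - 2 * ((n : ℝ) ^ 2 * (lambertA q n * lambertU q n)))
      (4 * (∑' n, lambertA q n * lambertU q n) ^ 2) := by
  have hG := hasSum_mul_lambertA hq
  obtain ⟨s, h3, h4⟩ := exists_hasSum_sq_mul_tail hq
  have h1 := hasSum_lambertA_mul_add_sq hq
  have h2 := hasSum_lambertA_mul_sub_sq hq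
  have hprod : HasSum (fun p : ℕ × ℕ => 4 * ((p.1 * lambertA q p.1) * (p.2 * lambertA q p.2)))
      (4 * (∑' n, lambertA q n * lambertU q n) ^ 2) := by
    have hs := summable_mul_of_summable_norm hG.summable.norm hG.summable.norm
    rw [sq]
    exact (hG.mul hG hs).mul_left 4
  have hval : (∑' p : ℕ × ℕ, lambertA q p.1 * lambertA q p.2 * ((p.1 : ℝ) + p.2) ^ 2) -
      ∑' p : ℕ × ℕ, lambertA q p.1 * lambertA q p.2 * ((p.1 : ℝ) - p.2) ^ 2 =
      4 * (∑' n, lambertA q n * lambertU q n) ^ 2 := by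
    have hs := summable_lambertA_mul_lambertA_mul hq
      (c := fun i j => ((i : ℝ) + j) ^ 2) fun i j => (abs_of_nonneg (by positivity)).le
    rw [← hprod.tsum_eq, ← hs.tsum_sub (summable_lambertA_mul_sub_sq hq)]
    refine tsum_congr fun p => ?_
    ring
  have h := ((h1.sub h2).sub (h3.mul_left 2)).add (h4.mul_left 2)
  rw [hval, sub_add_cancel] at h
  convert! h using 1
  ext n
  rcases eq_or_ne n 0 with rfl | hn
  · simp
  · rw [lambertSum_succ, lambertU_eq hq hn]
    ring

lemma hasSum_mul_sub_sq (hq : |q| < 1) :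
    HasSum (fun n : ℕ => lambertA q n * lambertU q n * (n - 1 - 2 * lambertA q n) ^ 2)
      (2 * (∑' n, lambertA q n * lambertU q n) ^ 2 -
        ∑' n, (lambertA q n * lambertU q n) ^ 2) := by
  obtain ⟨s, h1, h2⟩ := exists_hasSum_sq_mul hq
  have hG := (summable_lambertA_mul_lambertU hq).hasSum
  have hE := (summable_lambertA_mul_lambertU_sq hq).hasSum
  have hR := (hasSum_four_mul_sq hq).unique
    ((((hasSum_cube_mul_lambertA hq).mul_left (5 / 3)).add
      ((hasSum_mul_lambertA hq).mul_left (1 / 3))).sub (h1.mul_left 2))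
  convert! ((h1.sub (h2.mul_left 2)).add hG).add (hE.mul_left 4) using 1
  · ext n
    rcases eq_or_ne n 0 with rfl | hn
    · simp
    · rw [lambertU_eq hq hn]
      ring
  · linarith

end Ramanujan

section Main

variable {q : ℝ}

lemma Z2_eq_tsum (q : ℝ) : Z2 q = ∑' n, lambertA q n * lambertU q n := by
  rw [Z2, tsum_pnat_eq_tsum (f := fun n => q ^ n / (1 - q ^ n) ^ 2) (by simp)]
  refine tsum_congr fun n => ?_
  rw [lambertA, lambertU, div_eq_mul_inv, sq, mul_inv, mul_assoc]

lemma Z4_eq_tsum (q : ℝ) : Z4 q = ∑' n, (lambertA q n * lambertU q n) ^ 2 := by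
  rw [Z4, tsum_pnat_eq_tsum (f := fun n => q ^ (2 * n) / (1 - q ^ n) ^ 4) (by simp)]
  refine tsum_congr fun n => ?_
  rw [lambertA, lambertU, div_eq_mul_inv, ← inv_pow, mul_comm 2 n, pow_mul]
  ring

lemma tsum_pnat_triple (q : ℝ) :
    ∑' i : ℕ+, ∑' j : ℕ+, ∑' k : ℕ+, q ^ ((i : ℕ) + (j : ℕ) + (k : ℕ)) /
      ((1 - q ^ (i : ℕ)) * (1 - q ^ (j : ℕ)) * (1 - q ^ (k : ℕ)) *
        (1 - q ^ ((i : ℕ) + (j : ℕ) + (k : ℕ)))) =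
    ∑' i, ∑' j, ∑' k, q ^ (i + j + k) * lambertU q i * lambertU q j * lambertU q k *
      lambertU q (i + j + k) := by
  rw [← tsum_pnat_eq_tsum (by simp)]
  refine tsum_congr fun i => ?_
  rw [← tsum_pnat_eq_tsum (by simp)]
  refine tsum_congr fun j => ?_
  rw [← tsum_pnat_eq_tsum (by simp)]
  refine tsum_congr fun k => ?_
  simp only [lambertU, div_eq_mul_inv, mul_inv]
  ring

lemma tsum_pnat_quadruple (q : ℝ) :
    (∑' i : ℕ+, ∑' j : ℕ+, ∑' k : ℕ+, ∑' l : ℕ+,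
      if (i : ℕ) + (j : ℕ) = (k : ℕ) + (l : ℕ) then q ^ ((i : ℕ) + (j : ℕ)) /
        ((1 - q ^ (i : ℕ)) * (1 - q ^ (j : ℕ)) * (1 - q ^ (k : ℕ)) * (1 - q ^ (l : ℕ))) else 0) =
    ∑' i, ∑' j, ∑' k, quadTerm q i j k := by
  rw [← tsum_pnat_eq_tsum (by simp [quadTerm])]
  refine tsum_congr fun i => ?_
  rw [← tsum_pnat_eq_tsum (by simp [quadTerm])]
  refine tsum_congr fun j => ?_
  rw [← tsum_pnat_eq_tsum (by simp [quadTerm])]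
  refine tsum_congr fun k => ?_
  rw [tsum_pnat_eq_tsum (f := fun l => if (i : ℕ) + (j : ℕ) = (k : ℕ) + l then
    q ^ ((i : ℕ) + (j : ℕ)) / ((1 - q ^ (i : ℕ)) * (1 - q ^ (j : ℕ)) * (1 - q ^ (k : ℕ)) *
      (1 - q ^ l)) else 0) (by simp), tsum_eq_single ((i : ℕ) + j - k)]
  · rw [quadTerm]
    refine if_congr (by omega) ?_ rfl
    simp only [lambertU, div_eq_mul_inv, mul_inv]
    ring
  · intro l hl
    rw [if_neg (by omega)]

end Main

theorem Theta2_eq (q : ℝ) (hq : |q| < 1) :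
    -(1 / 3) * (∑' i : ℕ+, ∑' j : ℕ+, ∑' k : ℕ+, q ^ ((i : ℕ) + (j : ℕ) + (k : ℕ)) / ((1 - q ^ (i : ℕ)) * (1 - q ^ (j : ℕ)) * (1 - q ^ (k : ℕ)) * (1 - q ^ ((i : ℕ) + (j : ℕ) + (k : ℕ))))) + (1 / 4) * (∑' i : ℕ+, ∑' j : ℕ+, ∑' k : ℕ+, ∑' l : ℕ+, if (i : ℕ) + (j : ℕ) = (k : ℕ) + (l : ℕ) then q ^ ((i : ℕ) + (j : ℕ)) / ((1 - q ^ (i : ℕ)) * (1 - q ^ (j : ℕ)) * (1 - q ^ (k : ℕ)) * (1 - q ^ (l : ℕ))) else 0) = (1 / 3) * (Z2 q) ^ 2 - (1 / 12) * Z4 q := by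
  rw [tsum_pnat_triple, tsum_pnat_quadruple, Z2_eq_tsum, Z4_eq_tsum]
  have h := (((hasSum_quadTerm_antidiagonal hq).add
    ((hasSum_quadTerm_split hq).mul_left 2)).sub ((hasSum_tripleTerm hq).mul_left 4)).unique
    (a₂ := 2 * (∑' n, lambertA q n * lambertU q n) ^ 2 -
      ∑' n, (lambertA q n * lambertU q n) ^ 2) <| by
    convert! hasSum_mul_sub_sq hq using 1
    ext n
    rw [lambertSum_succ]
    ring
  linarith
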